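/- arXiv:1605.04000 — 2 statements merged into one kernel-verified Lean document; each statement's English description precedes it below -/
import Mathlib

section
/- There exists a 21×21 matrix with nonnegative integer entries whose nonnegative rank over ℝ is strictly smaller than its nonnegative rank over ℚ; in fact, the explicit matrix ℳ of the paper satisfies rank_{ℝ+} ℳ ≤ 19 while rank_{ℚ+} ℳ ≥ 20. This gives a negative answer to the Cohen–Rothblum problem: a rational nonnegative matrix of nonnegative rank k need not be a sum of k rational nonnegative rank-one matrices. -/
/-- `A` is a sum of `k` rank-one matrices with nonnegative entries in the subfield `F` of `ℝ`. -/
def NNDecomp (F : Subfield ℝ) {m n : Type*} (A : Matrix m n ℝ) (k : ℕ) : Prop :=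
  ∃ u : Fin k → m → ℝ, ∃ v : Fin k → n → ℝ,
    (∀ l i, 0 ≤ u l i ∧ u l i ∈ F) ∧ (∀ l j, 0 ≤ v l j ∧ v l j ∈ F) ∧
    A = ∑ l, Matrix.vecMulVec (u l) (v l)

/-- The nonnegative rank of `A` with respect to the subfield `F` of `ℝ`. -/
noncomputable def nnRank (F : Subfield ℝ) {m n : Type*} (A : Matrix m n ℝ) : ℕ :=
  sInf {k | NNDecomp F A k}

/-- `A` is a sum of `k` rank-one matrices with nonnegative rational entries. -/
def NNDecompQ {m n : Type*} (A : Matrix m n ℚ) (k : ℕ) : Prop :=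
  ∃ u : Fin k → m → ℚ, ∃ v : Fin k → n → ℚ,
    (∀ l i, 0 ≤ u l i) ∧ (∀ l j, 0 ≤ v l j) ∧
    A = ∑ l, Matrix.vecMulVec (u l) (v l)

/-- The nonnegative rank of a rational matrix `A` with respect to `ℚ`. -/
noncomputable def nnRankQ {m n : Type*} (A : Matrix m n ℚ) : ℕ :=
  sInf {k | NNDecompQ A k}

/-- The explicit 21 × 21 matrix ℳ of the paper. -/
def Mcal (K : Type*) [Zero K] [One K] [OfNat K 2] : Matrix (Fin 21) (Fin 21) K :=
  Matrix.of
    ![![2,2,2,1,0,0,0,0,0,0,0,0,0,0,0,0,0,1,1,1,1],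
      ![1,2,1,0,1,0,0,0,0,0,0,0,0,0,0,0,0,0,0,0,0],
      ![0,0,1,2,0,0,0,0,0,0,0,0,0,1,1,1,1,0,0,0,0],
      ![0,1,0,0,2,0,0,0,0,1,1,1,1,0,0,0,0,0,0,0,0],
      ![0,1,1,2,2,1,1,1,1,0,0,0,0,0,0,0,0,0,0,0,0],
      ![0,0,0,1,1,1,1,0,0,0,0,0,0,0,0,0,0,0,0,0,0],
      ![0,0,0,0,0,0,1,1,0,0,0,0,0,0,0,0,0,0,0,0,0],
      ![0,0,0,0,0,0,0,1,1,0,0,0,0,0,0,0,0,0,0,0,0],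
      ![0,0,0,0,0,1,0,0,1,0,0,0,0,0,0,0,0,0,0,0,0],
      ![0,0,0,0,1,0,0,0,0,1,1,0,0,0,0,0,0,0,0,0,0],
      ![0,0,0,0,0,0,0,0,0,0,1,1,0,0,0,0,0,0,0,0,0],
      ![0,0,0,0,0,0,0,0,0,0,0,1,1,0,0,0,0,0,0,0,0],
      ![0,0,0,0,0,0,0,0,0,1,0,0,1,0,0,0,0,0,0,0,0],
      ![0,0,0,1,0,0,0,0,0,0,0,0,0,1,1,0,0,0,0,0,0],
      ![0,0,0,0,0,0,0,0,0,0,0,0,0,0,1,1,0,0,0,0,0],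
      ![0,0,0,0,0,0,0,0,0,0,0,0,0,0,0,1,1,0,0,0,0],
      ![0,0,0,0,0,0,0,0,0,0,0,0,0,1,0,0,1,0,0,0,0],
      ![1,0,0,0,0,0,0,0,0,0,0,0,0,0,0,0,0,1,1,0,0],
      ![0,0,0,0,0,0,0,0,0,0,0,0,0,0,0,0,0,0,1,1,0],
      ![0,0,0,0,0,0,0,0,0,0,0,0,0,0,0,0,0,0,0,1,1],
      ![0,0,0,0,0,0,0,0,0,0,0,0,0,0,0,0,0,1,0,0,1]]

set_option maxHeartbeats 4000000 in
theorem Mcal_cast (K : Type*) [Semiring K] (i j : Fin 21) :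
    Mcal K i j = ((Mcal ℕ i j : ℕ) : K) := by
  fin_cases i <;> fin_cases j <;> simp [Mcal]

/-- Rational parts of the (doubled) left factors. -/
def Ua : Fin 19 → Fin 21 → ℤ :=
  ![![0,2,0,0,0,0,0,0,0,0,0,0,0,0,0,0,0,0,0,0,0],
    ![4,0,2,0,2,0,0,0,0,0,0,0,0,0,0,0,0,0,0,0,0],
    ![0,4,0,2,2,0,0,0,0,0,0,0,0,0,0,0,0,0,0,0,0],
    ![0,0,0,0,2,2,0,0,0,0,0,0,0,0,0,0,0,0,0,0,0],
    ![0,0,0,0,0,0,2,0,0,0,0,0,0,0,0,0,0,0,0,0,0],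
    ![0,0,0,0,2,0,0,2,0,0,0,0,0,0,0,0,0,0,0,0,0],
    ![0,0,0,0,0,0,0,0,2,0,0,0,0,0,0,0,0,0,0,0,0],
    ![0,0,0,2,0,0,0,0,0,2,0,0,0,0,0,0,0,0,0,0,0],
    ![0,0,0,0,0,0,0,0,0,0,2,0,0,0,0,0,0,0,0,0,0],
    ![0,0,0,2,0,0,0,0,0,0,0,2,0,0,0,0,0,0,0,0,0],
    ![0,0,0,0,0,0,0,0,0,0,0,0,2,0,0,0,0,0,0,0,0],
    ![0,0,2,0,0,0,0,0,0,0,0,0,0,2,0,0,0,0,0,0,0],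
    ![0,0,0,0,0,0,0,0,0,0,0,0,0,0,2,0,0,0,0,0,0],
    ![0,0,2,0,0,0,0,0,0,0,0,0,0,0,0,2,0,0,0,0,0],
    ![0,0,0,0,0,0,0,0,0,0,0,0,0,0,0,0,2,0,0,0,0],
    ![4,0,0,0,0,0,0,0,0,0,0,0,0,0,0,0,0,2,0,0,0],
    ![-2,0,0,0,0,0,0,0,0,0,0,0,0,0,0,0,0,0,2,0,0],
    ![4,0,0,0,0,0,0,0,0,0,0,0,0,0,0,0,0,0,0,2,0],
    ![-2,0,0,0,0,0,0,0,0,0,0,0,0,0,0,0,0,0,0,0,2]]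

/-- Coefficients of `√2` in the (doubled) left factors. -/
def Ub : Fin 19 → Fin 21 → ℤ :=
  ![![2,0,0,0,0,0,0,0,0,0,0,0,0,0,0,0,0,0,0,0,0],
    ![-2,0,0,0,0,0,0,0,0,0,0,0,0,0,0,0,0,0,0,0,0],
    ![0,-2,0,0,0,0,0,0,0,0,0,0,0,0,0,0,0,0,0,0,0],
    ![0,0,0,0,-1,0,0,0,0,0,0,0,0,0,0,0,0,0,0,0,0],
    ![0,0,0,0,1,0,0,0,0,0,0,0,0,0,0,0,0,0,0,0,0],
    ![0,0,0,0,-1,0,0,0,0,0,0,0,0,0,0,0,0,0,0,0,0],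
    ![0,0,0,0,1,0,0,0,0,0,0,0,0,0,0,0,0,0,0,0,0],
    ![0,0,0,-1,0,0,0,0,0,0,0,0,0,0,0,0,0,0,0,0,0],
    ![0,0,0,1,0,0,0,0,0,0,0,0,0,0,0,0,0,0,0,0,0],
    ![0,0,0,-1,0,0,0,0,0,0,0,0,0,0,0,0,0,0,0,0,0],
    ![0,0,0,1,0,0,0,0,0,0,0,0,0,0,0,0,0,0,0,0,0],
    ![0,0,-1,0,0,0,0,0,0,0,0,0,0,0,0,0,0,0,0,0,0],
    ![0,0,1,0,0,0,0,0,0,0,0,0,0,0,0,0,0,0,0,0,0],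
    ![0,0,-1,0,0,0,0,0,0,0,0,0,0,0,0,0,0,0,0,0,0],
    ![0,0,1,0,0,0,0,0,0,0,0,0,0,0,0,0,0,0,0,0,0],
    ![-2,0,0,0,0,0,0,0,0,0,0,0,0,0,0,0,0,0,0,0,0],
    ![2,0,0,0,0,0,0,0,0,0,0,0,0,0,0,0,0,0,0,0,0],
    ![-2,0,0,0,0,0,0,0,0,0,0,0,0,0,0,0,0,0,0,0,0],
    ![2,0,0,0,0,0,0,0,0,0,0,0,0,0,0,0,0,0,0,0,0]]

/-- Rational parts of the (doubled) right factors. -/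
def Va : Fin 19 → Fin 21 → ℤ :=
  ![![2,0,2,0,0,0,0,0,0,0,0,0,0,0,0,0,0,0,0,0,0],
    ![0,0,2,2,0,0,0,0,0,0,0,0,0,0,0,0,0,0,0,0,0],
    ![0,2,0,0,2,0,0,0,0,0,0,0,0,0,0,0,0,0,0,0,0],
    ![0,0,0,2,2,2,2,0,0,0,0,0,0,0,0,0,0,0,0,0,0],
    ![0,0,0,0,0,0,2,2,0,0,0,0,0,0,0,0,0,0,0,0,0],
    ![0,0,0,0,0,0,0,2,2,0,0,0,0,0,0,0,0,0,0,0,0],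
    ![0,0,0,0,0,2,0,0,2,0,0,0,0,0,0,0,0,0,0,0,0],
    ![0,0,0,0,2,0,0,0,0,2,2,0,0,0,0,0,0,0,0,0,0],
    ![0,0,0,0,0,0,0,0,0,0,2,2,0,0,0,0,0,0,0,0,0],
    ![0,0,0,0,0,0,0,0,0,0,0,2,2,0,0,0,0,0,0,0,0],
    ![0,0,0,0,0,0,0,0,0,2,0,0,2,0,0,0,0,0,0,0,0],
    ![0,0,0,2,0,0,0,0,0,0,0,0,0,2,2,0,0,0,0,0,0],
    ![0,0,0,0,0,0,0,0,0,0,0,0,0,0,2,2,0,0,0,0,0],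
    ![0,0,0,0,0,0,0,0,0,0,0,0,0,0,0,2,2,0,0,0,0],
    ![0,0,0,0,0,0,0,0,0,0,0,0,0,2,0,0,2,0,0,0,0],
    ![2,0,0,0,0,0,0,0,0,0,0,0,0,0,0,0,0,2,2,0,0],
    ![0,0,0,0,0,0,0,0,0,0,0,0,0,0,0,0,0,0,2,2,0],
    ![0,0,0,0,0,0,0,0,0,0,0,0,0,0,0,0,0,0,0,2,2],
    ![0,0,0,0,0,0,0,0,0,0,0,0,0,0,0,0,0,2,0,0,2]]

/-- Coefficients of `√2` in the (doubled) right factors. -/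
def Vb : Fin 19 → Fin 21 → ℤ :=
  ![![0,2,0,0,0,0,0,0,0,0,0,0,0,0,0,0,0,0,0,0,0],
    ![0,0,0,1,0,0,0,0,0,0,0,0,0,0,0,0,0,0,0,0,0],
    ![0,0,0,0,1,0,0,0,0,0,0,0,0,0,0,0,0,0,0,0,0],
    ![0,0,0,0,0,0,0,0,0,0,0,0,0,0,0,0,0,0,0,0,0],
    ![0,0,0,0,0,0,0,0,0,0,0,0,0,0,0,0,0,0,0,0,0],
    ![0,0,0,0,0,0,0,0,0,0,0,0,0,0,0,0,0,0,0,0,0],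
    ![0,0,0,0,0,0,0,0,0,0,0,0,0,0,0,0,0,0,0,0,0],
    ![0,0,0,0,0,0,0,0,0,0,0,0,0,0,0,0,0,0,0,0,0],
    ![0,0,0,0,0,0,0,0,0,0,0,0,0,0,0,0,0,0,0,0,0],
    ![0,0,0,0,0,0,0,0,0,0,0,0,0,0,0,0,0,0,0,0,0],
    ![0,0,0,0,0,0,0,0,0,0,0,0,0,0,0,0,0,0,0,0,0],
    ![0,0,0,0,0,0,0,0,0,0,0,0,0,0,0,0,0,0,0,0,0],
    ![0,0,0,0,0,0,0,0,0,0,0,0,0,0,0,0,0,0,0,0,0],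
    ![0,0,0,0,0,0,0,0,0,0,0,0,0,0,0,0,0,0,0,0,0],
    ![0,0,0,0,0,0,0,0,0,0,0,0,0,0,0,0,0,0,0,0,0],
    ![0,0,0,0,0,0,0,0,0,0,0,0,0,0,0,0,0,0,0,0,0],
    ![0,0,0,0,0,0,0,0,0,0,0,0,0,0,0,0,0,0,0,0,0],
    ![0,0,0,0,0,0,0,0,0,0,0,0,0,0,0,0,0,0,0,0,0],
    ![0,0,0,0,0,0,0,0,0,0,0,0,0,0,0,0,0,0,0,0,0]]

/-- A decidable certificate for `0 ≤ a + b √2`. -/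
def certNN (a b : ℤ) : Prop :=
  (0 ≤ a ∧ 0 ≤ b) ∨ (0 ≤ a ∧ 2 * b ^ 2 ≤ a ^ 2) ∨ (0 ≤ b ∧ a ^ 2 ≤ 2 * b ^ 2)

instance (a b : ℤ) : Decidable (certNN a b) := by unfold certNN; infer_instance

theorem certNN.nonneg {a b : ℤ} (h : certNN a b) : 0 ≤ ((a : ℝ) + b * √2) / 2 := by
  have h2 : (√2 : ℝ) ^ 2 = 2 := Real.sq_sqrt (by norm_num)
  have h0 : 0 ≤ (√2 : ℝ) := Real.sqrt_nonneg 2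
  have : 0 ≤ (a : ℝ) + b * √2 := by
    rcases h with ⟨h1, h3⟩ | ⟨h1, h3⟩ | ⟨h1, h3⟩
    · have : (0 : ℝ) ≤ a := by exact_mod_cast h1
      have : (0 : ℝ) ≤ b := by exact_mod_cast h3
      positivity
    · have h1' : (0 : ℝ) ≤ a := by exact_mod_cast h1
      have h3' : 2 * (b : ℝ) ^ 2 ≤ a ^ 2 := by exact_mod_cast h3
      have := abs_le_of_sq_le_sq (a := (b : ℝ) * √2) (b := a) (by rw [mul_pow, h2]; linarith) h1'
      linarith [(abs_le.1 this).1]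
    · have h1' : (0 : ℝ) ≤ b := by exact_mod_cast h1
      have h3' : (a : ℝ) ^ 2 ≤ 2 * b ^ 2 := by exact_mod_cast h3
      have := abs_le_of_sq_le_sq (a := (a : ℝ)) (b := b * √2) (by rw [mul_pow, h2]; linarith)
        (by positivity)
      linarith [(abs_le.1 this).1]
  linarith

theorem certU : ∀ l i, certNN (Ua l i) (Ub l i) := by decide +kernel
theorem certV : ∀ l i, certNN (Va l i) (Vb l i) := by decide +kernel
theorem certA : ∀ i j, ∑ l, (Ua l i * Va l j + 2 * (Ub l i * Vb l j)) = 4 * (Mcal ℕ i j : ℤ) := by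
  decide +kernel
theorem certB : ∀ i j, ∑ l, (Ua l i * Vb l j + Ub l i * Va l j) = 0 := by
  decide +kernel

theorem upper : NNDecomp ⊤ (Mcal ℝ) 19 := by
  refine ⟨fun l i => ((Ua l i : ℝ) + Ub l i * √2) / 2, fun l i => ((Va l i : ℝ) + Vb l i * √2) / 2,
    fun l i => ⟨(certU l i).nonneg, trivial⟩, fun l i => ⟨(certV l i).nonneg, trivial⟩, ?_⟩
  ext i j
  have h2 : (√2 : ℝ) * √2 = 2 := Real.mul_self_sqrt (by norm_num)
  have hA : ∑ l, ((Ua l i : ℝ) * Va l j + 2 * (Ub l i * Vb l j)) = 4 * (Mcal ℕ i j : ℝ) := by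
    exact_mod_cast certA i j
  have hB : ∑ l, ((Ua l i : ℝ) * Vb l j + Ub l i * Va l j) = 0 := by
    exact_mod_cast certB i j
  rw [Mcal_cast, Matrix.sum_apply]
  have : ∀ l, Matrix.vecMulVec (fun i => ((Ua l i : ℝ) + Ub l i * √2) / 2)
      (fun i => ((Va l i : ℝ) + Vb l i * √2) / 2) i j =
      (1 / 4) * ((Ua l i : ℝ) * Va l j + 2 * (Ub l i * Vb l j)) +
      (√2 / 4) * ((Ua l i : ℝ) * Vb l j + Ub l i * Va l j) := by
    intro l
    rw [Matrix.vecMulVec_apply]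
    linear_combination (Ub l i * Vb l j / 4 : ℝ) * h2
  rw [Finset.sum_congr rfl fun l _ => this l, Finset.sum_add_distrib, ← Finset.mul_sum,
    ← Finset.mul_sum, hA, hB]
  ring

theorem nonemptyQ : NNDecompQ (Mcal ℚ) 21 := by
  refine ⟨fun l i => if i = l then 1 else 0, fun l j => Mcal ℚ l j, ?_, ?_, ?_⟩
  · intro l i; dsimp only; split_ifs <;> norm_num
  · intro l j; exact (Nat.cast_nonneg _).trans_eq (Mcal_cast ℚ l j).symm
  · ext i j
    simp [Matrix.sum_apply, Matrix.vecMulVec_apply]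

/-- The support of the matrix. -/
def supp (i j : Fin 21) : Bool := Mcal ℕ i j != 0

/-- Two positions which can lie in the support of the same rank-one summand. -/
def compat (p q : Fin 21 × Fin 21) : Prop := supp p.1 q.2 = true ∧ supp q.1 p.2 = true

instance (p q) : Decidable (compat p q) := by unfold compat; infer_instance

/-- The special positions used for counting. -/
def ent : Fin 35 → Fin 21 × Fin 21 :=
  ![(1, 0), (2, 2), (3, 1), (5, 5), (5, 6), (6, 6), (6, 7), (7, 7), (7, 8), (8, 8), (8, 5), (9, 9), (9, 10), (10, 10), (10, 11), (11, 11), (11, 12), (12, 12), (12, 9), (13, 13), (13, 14), (14, 14), (14, 15), (15, 15), (15, 16), (16, 16), (16, 13), (17, 17), (17, 18), (18, 18), (18, 19), (19, 19), (19, 20), (20, 20), (20, 17)]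

/-- Weights of special positions. -/
def wt (n : Fin 35) : ℕ := if n.1 < 3 then 2 else 1

theorem wt_sum : ∑ n, wt n = 38 := by decide +kernel
theorem ent_supp : ∀ n, Mcal ℕ (ent n).1 (ent n).2 ≠ 0 := by decide +kernel
theorem ent_pair : ∀ m n, m ≠ n → compat (ent m) (ent n) → wt m = 1 := by decide +kernel
theorem ent_triple : ∀ a b, a ≠ b → compat (ent a) (ent b) → ∀ c, a ≠ c → b ≠ c →
    compat (ent a) (ent c) → ¬ compat (ent b) (ent c) := by decide +kernel

theorem wt_le (T : Finset (Fin 35)) (hT : ∀ a ∈ T, ∀ b ∈ T, compat (ent a) (ent b)) :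
    ∑ n ∈ T, wt n ≤ 2 := by
  by_cases h : ∃ a ∈ T, ∃ b ∈ T, a ≠ b
  · obtain ⟨a, ha, b, hb, hab⟩ := h
    have h1 : ∀ n ∈ T, wt n = 1 := by
      intro n hn
      by_cases hna : n = a
      · subst hna; exact ent_pair _ _ hab (hT _ ha _ hb)
      · exact ent_pair _ _ hna (hT _ hn _ ha)
    rw [Finset.sum_congr rfl h1]
    simp only [Finset.sum_const, smul_eq_mul, mul_one]
    by_contra! hc
    obtain ⟨x, y, z, hx, hy, hz, hxy, hxz, hyz⟩ := Finset.two_lt_card_iff.1 hc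
    exact ent_triple x y hxy (hT _ hx _ hy) z hxz hyz (hT _ hx _ hz) (hT _ hy _ hz)
  · push Not at h
    rcases T.eq_empty_or_nonempty with rfl | ⟨a, ha⟩
    · simp
    · have : T = {a} := by
        ext b; simp only [Finset.mem_singleton]
        exact ⟨fun hb => h b hb a ha, fun hb => hb ▸ ha⟩
      rw [this, Finset.sum_singleton]
      unfold wt; split_ifs <;> norm_num

set_option maxHeartbeats 1000000 in
theorem lower {k : ℕ} (hk : k ≤ 19) : ¬ NNDecompQ (Mcal ℚ) k := by
  classical
  rintro ⟨u, v, hu, hv, hM⟩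
  obtain ⟨f, hf⟩ : ∃ f : Fin k → Fin 21 → Fin 21 → ℚ, ∀ l i j, f l i j = u l i * v l j :=
    ⟨_, fun _ _ _ => rfl⟩
  have f0 : ∀ l i j, 0 ≤ f l i j := fun l i j => by rw [hf]; exact mul_nonneg (hu l i) (hv l j)
  have fx : ∀ l i j i' j', f l i j * f l i' j' = f l i j' * f l i' j := by
    intro l i j i' j'; simp only [hf]; ring
  have fsum : ∀ i j, ∑ l, f l i j = (Mcal ℕ i j : ℚ) := by
    intro i j
    rw [← Mcal_cast, hM, Matrix.sum_apply]
    exact Finset.sum_congr rfl fun l _ => by rw [hf, Matrix.vecMulVec_apply]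
  have fle : ∀ l i j, f l i j ≤ (Mcal ℕ i j : ℚ) := by
    intro l i j; rw [← fsum]
    exact Finset.single_le_sum (f := fun l => f l i j) (fun l _ => f0 l i j) (Finset.mem_univ l)
  have fsupp : ∀ l i j, 0 < f l i j → supp i j = true := by
    intro l i j h
    have := h.trans_le (fle l i j)
    have : 0 < Mcal ℕ i j := by exact_mod_cast this
    simp [supp]; omega
  have fcompat : ∀ l i j i' j', 0 < f l i j → 0 < f l i' j' → compat (i, j) (i', j') := by
    intro l i j i' j' h h'
    have h3 : 0 < f l i j' * f l i' j := by rw [← fx]; exact mul_pos h h'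
    have a1 : 0 < f l i j' := lt_of_le_of_ne (f0 _ _ _) fun h => by simp [← h] at h3
    have a2 : 0 < f l i' j := lt_of_le_of_ne (f0 _ _ _) fun h => by simp [← h] at h3
    exact ⟨fsupp _ _ _ a1, fsupp _ _ _ a2⟩
  -- covering relation
  obtain ⟨c, hc⟩ : ∃ c : Fin k → Fin 35 → Prop,
    ∀ l n, c l n ↔ 0 < f l (ent n).1 (ent n).2 := ⟨_, fun _ _ => Iff.rfl⟩
  have cex : ∀ n, ∃ l, c l n := by
    intro n
    by_contra! h
    have : ∑ l, f l (ent n).1 (ent n).2 = 0 :=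
      Finset.sum_eq_zero fun l _ => le_antisymm (not_lt.1 (fun h' => h l ((hc l n).2 h'))) (f0 _ _ _)
    rw [fsum] at this
    exact ent_supp n (by exact_mod_cast this)
  have cw : ∀ l, ∑ n with c l n, wt n ≤ 2 := by
    intro l
    apply wt_le
    intro a ha b hb
    simp only [Finset.mem_filter, Finset.mem_univ, true_and] at ha hb
    exact fcompat l _ _ _ _ ((hc _ _).1 ha) ((hc _ _).1 hb)
  have dc : ∑ l, ∑ n with c l n, wt n = ∑ n, wt n * (Finset.univ.filter fun l => c l n).card := by
    simp only [Finset.sum_filter]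
    rw [Finset.sum_comm]
    refine Finset.sum_congr rfl fun n _ => ?_
    rw [← Finset.sum_filter, Finset.sum_const, smul_eq_mul, mul_comm]
  have up : ∑ l, ∑ n with c l n, wt n ≤ ∑ l : Fin k, 2 := Finset.sum_le_sum fun l _ => cw l
  have card1 : ∀ n, 1 ≤ (Finset.univ.filter fun l => c l n).card := by
    intro n
    obtain ⟨l, hl⟩ := cex n
    exact Finset.card_pos.2 ⟨l, by simpa using hl⟩
  have wle : ∀ n ∈ Finset.univ, wt n ≤ wt n * (Finset.univ.filter fun l => c l n).card :=
    fun n _ => Nat.le_mul_of_pos_right _ (card1 n)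
  have lo : ∑ n, wt n ≤ ∑ n, wt n * (Finset.univ.filter fun l => c l n).card :=
    Finset.sum_le_sum wle
  have hsum2 : ∑ l : Fin k, 2 = 2 * k := by simp [mul_comm]
  rw [wt_sum] at lo
  have ceq : ∀ l, ∑ n with c l n, wt n = 2 := by
    have := (Finset.sum_eq_sum_iff_of_le fun l (_ : l ∈ Finset.univ) => cw l).1 (by omega)
    exact fun l => this l (Finset.mem_univ l)
  have cuniq : ∀ n l l', c l n → c l' n → l = l' := by
    intro n l l' h h'
    have := (Finset.sum_eq_sum_iff_of_le wle).1 (by rw [wt_sum]; omega) n (Finset.mem_univ n)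
    have hw : 0 < wt n := by unfold wt; split_ifs <;> norm_num
    have h1 : (Finset.univ.filter fun l => c l n).card = 1 :=
      Nat.eq_of_mul_eq_mul_left hw (by rw [mul_one]; exact this.symm)
    exact Finset.card_le_one.1 h1.le l (by simpa using h) l' (by simpa using h')
  choose own hown using cex
  have cown : ∀ l n, c l n → l = own n := fun l n h => cuniq n l _ h (hown n)
  -- every summand covers a special position
  have fown : ∀ l i j, 0 < f l i j → ∃ n, l = own n ∧ compat (i, j) (ent n) := by
    intro l i j h
    have h2 : ∑ n with c l n, wt n ≠ 0 := by rw [ceq]; norm_num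
    obtain ⟨n, hn, -⟩ := Finset.exists_ne_zero_of_sum_ne_zero h2
    have hn : c l n := by simpa using hn
    exact ⟨n, cown l n hn, fcompat l _ _ _ _ h ((hc _ _).1 hn)⟩
  -- the summand covering position `(5, 3)` covers both `(5, 5)` and `(5, 6)`
  have star : ∀ j, (∀ n, compat (5, j) (ent n) → n = 3 ∨ n = 4) → ∀ l, 0 < f l 5 j →
      l = own 3 ∧ l = own 4 := by
    intro j hj l hl
    have hsub : (Finset.univ.filter fun n => c l n) ⊆ {3, 4} := by
      intro n hn
      have hn : c l n := by simpa using hn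
      simpa using hj n (fcompat l _ _ _ _ hl ((hc _ _).1 hn))
    have key : ∀ n ∈ ({3, 4} : Finset (Fin 35)), c l n := by
      intro n hn
      by_contra hcn
      have h1 : (Finset.univ.filter fun n => c l n) ⊆ ({3, 4} : Finset (Fin 35)).erase n :=
        Finset.subset_erase.2 ⟨hsub, by simpa using hcn⟩
      have h2 := Finset.sum_le_sum_of_subset (f := wt) h1
      rw [ceq] at h2
      have h3 : ∀ n ∈ ({3, 4} : Finset (Fin 35)),
        ∑ x ∈ ({3, 4} : Finset (Fin 35)).erase n, wt x = 1 := by decide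
      rw [h3 n hn] at h2
      omega
    exact ⟨cown _ _ (key 3 (by simp)), cown _ _ (key 4 (by simp))⟩
  have star3 := star 3 (by decide +kernel)
  have star4 := star 4 (by decide +kernel)
  have pos_of : ∀ i j, Mcal ℕ i j ≠ 0 → ∃ l, 0 < f l i j := by
    intro i j hij
    by_contra! h
    have : ∑ l, f l i j = 0 := Finset.sum_eq_zero fun l _ => le_antisymm (h l) (f0 _ _ _)
    rw [fsum] at this
    exact hij (by exact_mod_cast this)
  have h34 : own 4 = own 3 := by
    obtain ⟨l, hl⟩ := pos_of 5 3 (by decide +kernel)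
    rw [← (star3 l hl).1, ← (star3 l hl).2]
  -- evaluation lemmas
  have distinct : ∀ a b, ¬ compat (ent a) (ent b) → own a ≠ own b := by
    intro a b hab h
    have := hown b
    rw [← h] at this
    exact hab (fcompat _ _ _ _ _ ((hc _ _).1 (hown a)) ((hc _ _).1 this))
  have ev1 : ∀ a i j, (∀ n, compat (i, j) (ent n) → n = a ∨ (a = 3 ∧ n = 4)) →
      f (own a) i j = (Mcal ℕ i j : ℚ) := by
    intro a i j h
    rw [← fsum, Finset.sum_eq_single (own a)]
    · intro l _ hl
      by_contra h'
      obtain ⟨n, rfl, hn⟩ := fown l i j (lt_of_le_of_ne (f0 _ _ _) (Ne.symm h'))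
      rcases h n hn with rfl | ⟨rfl, rfl⟩
      · exact hl rfl
      · exact hl h34
    · simp
  have ev2 : ∀ a b i j, ¬ compat (ent a) (ent b) →
      (∀ n, compat (i, j) (ent n) → n = a ∨ n = b ∨ (b = 3 ∧ n = 4)) →
      f (own a) i j + f (own b) i j = (Mcal ℕ i j : ℚ) := by
    intro a b i j hab h
    rw [← fsum, ← Finset.sum_pair (distinct a b hab) (f := fun l => f l i j)]
    apply Finset.sum_subset (Finset.subset_univ _)
    intro l _ hl
    simp only [Finset.mem_insert, Finset.mem_singleton, not_or] at hl
    by_contra h'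
    obtain ⟨n, rfl, hn⟩ := fown l i j (lt_of_le_of_ne (f0 _ _ _) (Ne.symm h'))
    rcases h n hn with rfl | rfl | ⟨rfl, rfl⟩
    · exact hl.1 rfl
    · exact hl.2 rfl
    · exact hl.2 h34
  have fz : ∀ l i j i' j', 0 < f l i j → ¬ compat (i, j) (i', j') → f l i' j' = 0 := by
    intro l i j i' j' h hn
    by_contra h'
    exact hn (fcompat _ _ _ _ _ h (lt_of_le_of_ne (f0 _ _ _) (Ne.symm h')))
  have m41 : (Mcal ℕ 4 1) = 1 := by decide +kernel
  have m42 : (Mcal ℕ 4 2) = 1 := by decide +kernel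
  have m43 : (Mcal ℕ 4 3) = 2 := by decide +kernel
  have m44 : (Mcal ℕ 4 4) = 2 := by decide +kernel
  have m45 : (Mcal ℕ 4 5) = 1 := by decide +kernel
  have m53 : (Mcal ℕ 5 3) = 1 := by decide +kernel
  have m54 : (Mcal ℕ 5 4) = 1 := by decide +kernel
  have m55 : (Mcal ℕ 5 5) = 1 := by decide +kernel
  have m01 : (Mcal ℕ 0 1) = 2 := by decide +kernel
  have m02 : (Mcal ℕ 0 2) = 2 := by decide +kernel
  have m03 : (Mcal ℕ 0 3) = 1 := by decide +kernel
  have m11 : (Mcal ℕ 1 1) = 2 := by decide +kernel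
  have m12 : (Mcal ℕ 1 2) = 1 := by decide +kernel
  have m14 : (Mcal ℕ 1 4) = 1 := by decide +kernel
  -- the summand `own 3` on the first gadget
  have g53 : f (own 3) 5 3 = 1 := by
    rw [ev1 3 5 3 (by decide +kernel), m53]; norm_num
  have g54 : f (own 3) 5 4 = 1 := by
    rw [ev1 3 5 4 (by decide +kernel), m54]; norm_num
  have g55 : f (own 3) 5 5 = 1 := by
    rw [← Nat.cast_one, ← m55, ← fsum, Finset.sum_eq_single (own 3)]
    · intro l _ hl
      by_contra h'
      exact hl (cown l 3 ((hc _ _).2 (lt_of_le_of_ne (f0 _ _ _) (Ne.symm h'))))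
    · simp
  have g45 : f (own 3) 4 5 ≤ 1 := by simpa [m45] using fle (own 3) 4 5
  have x1 := fx (own 3) 4 3 5 5
  have x2 := fx (own 3) 4 4 5 5
  rw [g53, g55] at x1
  rw [g54, g55] at x2
  have e41 := ev1 2 4 1 (by decide +kernel)
  have e42 := ev1 1 4 2 (by decide +kernel)
  have e03 := ev1 1 0 3 (by decide +kernel)
  have e43 := ev2 1 3 4 3 (by decide +kernel) (by decide +kernel)
  have e44 := ev2 2 3 4 4 (by decide +kernel) (by decide +kernel)
  have e02 := ev2 0 1 0 2 (by decide +kernel) (by decide +kernel)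
  have e01 := ev2 0 2 0 1 (by decide +kernel) (by decide +kernel)
  have e11 := ev2 0 2 1 1 (by decide +kernel) (by decide +kernel)
  have e12 := ev2 0 1 1 2 (by decide +kernel) (by decide +kernel)
  have e14 := ev2 0 2 1 4 (by decide +kernel) (by decide +kernel)
  rw [m41] at e41
  rw [m42] at e42
  rw [m03] at e03
  rw [m43] at e43
  rw [m44] at e44
  rw [m02] at e02
  rw [m01] at e01
  rw [m11] at e11
  rw [m12] at e12
  rw [m14] at e14
  push_cast at e41 e42 e03 e43 e44 e02 e01 e11 e12 e14
  have s2 : 0 < f (own 1) 4 3 := by linarith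
  have s3 : f (own 2) 4 4 = f (own 1) 4 3 := by linarith
  have z1 : f (own 2) 0 1 = 0 := fz _ 4 4 _ _ (by linarith) (by decide +kernel)
  have z2 : f (own 0) 1 4 = 0 := fz _ 0 1 _ _ (by linarith) (by decide +kernel)
  have z3 : f (own 1) 1 2 = 0 := fz _ 4 3 _ _ s2 (by decide +kernel)
  have y1 := fx (own 1) 0 2 4 3
  have y2 := fx (own 2) 1 1 4 4
  have y3 := fx (own 0) 0 2 1 1
  generalize f (own 1) 4 3 = s at *
  rw [e03, e42] at y1
  rw [s3, e41] at y2
  have w1 : f (own 0) 0 1 = 2 := by linarith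
  have w2 : f (own 0) 1 2 = 1 := by linarith
  have w3 : f (own 2) 1 4 = 1 := by linarith
  rw [w1, w2] at y3
  rw [w3] at y2
  have w4 : f (own 2) 1 1 = f (own 1) 0 2 := by
    have : f (own 2) 1 1 * s = f (own 1) 0 2 * s := by linarith
    exact mul_right_cancel₀ s2.ne' this
  have w5 : f (own 0) 1 1 = f (own 0) 0 2 := by linarith
  rw [w5] at y3
  have sq : IsSquare (2 : ℚ) := ⟨f (own 0) 0 2, by linarith⟩
  have : Irrational (√2) := irrational_sqrt_two
  obtain ⟨q, hq⟩ := sq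
  apply this
  refine ⟨|q|, ?_⟩
  rw [show (2 : ℝ) = (q : ℝ) * q by exact_mod_cast hq, Real.sqrt_mul_self_eq_abs]
  push_cast
  rfl

theorem stmt13 :
    (∃ M : Matrix (Fin 21) (Fin 21) ℚ,
        (∀ i j, ∃ z : ℕ, M i j = (z : ℚ)) ∧
        nnRank ⊤ (M.map (Rat.cast : ℚ → ℝ)) < nnRankQ M) ∧
    nnRank ⊤ (Mcal ℝ) ≤ 19 ∧ 20 ≤ nnRankQ (Mcal ℚ) := by
  have hup : nnRank ⊤ (Mcal ℝ) ≤ 19 := Nat.sInf_le upper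
  have hlo : 20 ≤ nnRankQ (Mcal ℚ) := by
    by_contra! h
    exact lower (k := nnRankQ (Mcal ℚ)) (by omega) (Nat.sInf_mem (s := {k | NNDecompQ (Mcal ℚ) k}) ⟨21, nonemptyQ⟩)
  refine ⟨⟨Mcal ℚ, fun i j => ⟨_, Mcal_cast ℚ i j⟩, ?_⟩, hup, hlo⟩
  have hmap : (Mcal ℚ).map (Rat.cast : ℚ → ℝ) = Mcal ℝ := by
    ext i j
    rw [Matrix.map_apply, Mcal_cast ℚ, Mcal_cast ℝ]
    norm_cast
  rw [hmap]
  omega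
end

section
/- Let F be a subfield of ℝ. Let ℳ be the explicit 21×21 nonnegative integer matrix of the paper, and for a,b,c ∈ F let ℳ₁(a,b,c) denote the 9×9 matrix obtained from ℳ by removing its last twelve rows and columns and then replacing the (1,1) entry by a, the (3,4) entry by b, and the (4,5) entry by c. Then rank_{F+} ℳ = 12 + min { rank_{F+} ℳ₁(a,b,c) : a,b,c ∈ [1,2] ∩ F }. -/
/-- The 9 × 9 matrix ℳ₁(a,b,c): remove the last twelve rows and columns of ℳ and replace
the (1,1), (3,4), (4,5) entries by `a`, `b`, `c`. -/
def M1mat (a b c : ℝ) : Matrix (Fin 9) (Fin 9) ℝ :=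
  Matrix.of fun i j =>
    if (i, j) = (0, 0) then a
    else if (i, j) = (2, 3) then b
    else if (i, j) = (3, 4) then c
    else Mcal ℝ (Fin.castLE (by norm_num) i) (Fin.castLE (by norm_num) j)

/-- `x` is a nonnegative vector with entries in `F`. -/
def NNVec (F : Subfield ℝ) {m : Type*} (x : m → ℝ) : Prop := ∀ i, 0 ≤ x i ∧ x i ∈ F

theorem nnd_zero (F : Subfield ℝ) {m n : Type*} : NNDecomp F (0 : Matrix m n ℝ) 0 :=
  ⟨fun l => l.elim0, fun l => l.elim0, fun l => l.elim0, fun l => l.elim0, by simp⟩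

theorem nnd_add_one {F : Subfield ℝ} {m n : Type*} {A : Matrix m n ℝ} {k : ℕ}
    (h : NNDecomp F A k) {x : m → ℝ} {y : n → ℝ} (hx : NNVec F x) (hy : NNVec F y) :
    NNDecomp F (A + Matrix.vecMulVec x y) (k + 1) := by
  obtain ⟨u, v, hu, hv, rfl⟩ := h
  refine ⟨Fin.cons x u, Fin.cons y v, ?_, ?_, ?_⟩
  · intro l
    refine Fin.cases ?_ (fun l => ?_) l
    · exact hx
    · exact hu l
  · intro l
    refine Fin.cases ?_ (fun l => ?_) l
    · exact hy
    · exact hv l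
  · rw [Fin.sum_univ_succ]
    simp [add_comm]

theorem nnvec_zero (F : Subfield ℝ) {m : Type*} : NNVec F (0 : m → ℝ) :=
  fun _ => ⟨le_refl _, F.zero_mem⟩

theorem nnd_mono {F : Subfield ℝ} {m n : Type*} {A : Matrix m n ℝ} {k k' : ℕ}
    (h : NNDecomp F A k) (hk : k ≤ k') : NNDecomp F A k' := by
  induction hk with
  | refl => exact h
  | step _ ih => simpa using nnd_add_one ih (nnvec_zero F) (nnvec_zero F)

theorem nnd_add_sum {F : Subfield ℝ} {m n ι : Type*} {A : Matrix m n ℝ} {k : ℕ}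
    (h : NNDecomp F A k) (S : Finset ι) (u : ι → m → ℝ) (v : ι → n → ℝ)
    (hu : ∀ l, NNVec F (u l)) (hv : ∀ l, NNVec F (v l)) :
    NNDecomp F (A + ∑ l ∈ S, Matrix.vecMulVec (u l) (v l)) (k + S.card) := by
  classical
  induction S using Finset.induction_on with
  | empty => simpa using h
  | insert a s ha ih =>
    have := nnd_add_one ih (hu a) (hv a)
    rw [Finset.sum_insert ha, Finset.card_insert_of_notMem ha, add_comm (Matrix.vecMulVec _ _),
      ← add_assoc, ← add_assoc]
    exact this

theorem nnd_map {F : Subfield ℝ} {m n m' n' : Type*} {A : Matrix m n ℝ} {k : ℕ}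
    (h : NNDecomp F A k) (f : m' → m) (g : n' → n) : NNDecomp F (A.submatrix f g) k := by
  obtain ⟨u, v, hu, hv, rfl⟩ := h
  refine ⟨fun l i => u l (f i), fun l j => v l (g j), fun l i => hu l _, fun l j => hv l _, ?_⟩
  ext i j
  simp [Matrix.sum_apply, Matrix.vecMulVec_apply]

theorem nnd_exists (F : Subfield ℝ) {m n : Type*} [Fintype m] (A : Matrix m n ℝ)
    (h : ∀ i j, 0 ≤ A i j ∧ A i j ∈ F) : ∃ k, NNDecomp F A k := by
  classical
  refine ⟨0 + (Finset.univ : Finset m).card, ?_⟩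
  · have := nnd_add_sum (nnd_zero F (m := m) (n := n)) Finset.univ (fun i => Pi.single i (1 : ℝ))
      (fun i => A i) ?_ (fun i j => h i j)
    · have e : A = 0 + ∑ l ∈ Finset.univ, Matrix.vecMulVec (Pi.single l (1 : ℝ)) (A l) := by
        ext i j
        simp [Matrix.sum_apply, Matrix.vecMulVec_apply, Pi.single_apply]
      rw [← e] at this
      exact this
    · intro i j
      by_cases hij : j = i
      · subst hij; simpa using F.one_mem
      · simpa [hij] using F.zero_mem

/-- The cyclic 4 × 4 pattern. -/
def Cyc : Matrix (Fin 4) (Fin 4) ℝ :=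
  Matrix.of ![![1,1,0,0],![0,1,1,0],![0,0,1,1],![1,0,0,1]]

/-- The gadget attached to `A` at position `(p,q)`. -/
def Gad {m n : Type*} [DecidableEq m] [DecidableEq n] (A : Matrix m n ℝ) (p : m) (q : n) :
    Matrix (m ⊕ Fin 4) (n ⊕ Fin 4) ℝ :=
  Matrix.fromBlocks A (Matrix.of fun i _ => if i = p then 1 else 0)
    (Matrix.of fun i j => if i = 0 ∧ j = q then 1 else 0) Cyc

theorem cyc_fool (i j : Fin 4) (h : i ≠ j) : Cyc i j = 0 ∨ Cyc j i = 0 := by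
  fin_cases i <;> fin_cases j <;> simp_all [Cyc]

theorem cyc_diag (i : Fin 4) : Cyc i i = 1 := by
  fin_cases i <;> simp [Cyc]

theorem cyc_mem (F : Subfield ℝ) (i j : Fin 4) : 0 ≤ Cyc i j ∧ Cyc i j ∈ F := by
  have h0 := F.zero_mem
  have h1 := F.one_mem
  fin_cases i <;> fin_cases j <;> simp [Cyc, h0, h1]

theorem gad_back {F : Subfield ℝ} {m n : Type*} [DecidableEq m] [DecidableEq n]
    {A : Matrix m n ℝ} {p : m} {q : n} {t : ℝ} {k : ℕ} (ht : t ∈ F) (h0 : 0 ≤ t) (h1 : t ≤ 1)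
    (h : NNDecomp F (A - Matrix.single p q t) k) : NNDecomp F (Gad A p q) (k + 4) := by
  have hb : NNDecomp F (Matrix.fromBlocks (A - Matrix.single p q t) 0 0 0 :
      Matrix (m ⊕ Fin 4) (n ⊕ Fin 4) ℝ) k := by
    obtain ⟨u, v, hu, hv, e⟩ := h
    refine ⟨fun l => Sum.elim (u l) 0, fun l => Sum.elim (v l) 0, ?_, ?_, ?_⟩
    · rintro l (i | i)
      · exact hu l i
      · exact ⟨le_refl _, F.zero_mem⟩
    · rintro l (i | i)
      · exact hv l i
      · exact ⟨le_refl _, F.zero_mem⟩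
    · rw [e]
      ext (i | i) (j | j) <;> simp [Matrix.sum_apply, Matrix.vecMulVec_apply]
  have hz : (0 : ℝ) ≤ 0 ∧ (0 : ℝ) ∈ F := ⟨le_refl _, F.zero_mem⟩
  have ho : (0 : ℝ) ≤ 1 ∧ (1 : ℝ) ∈ F := ⟨zero_le_one, F.one_mem⟩
  have hα : ∀ i : Fin 4, 0 ≤ (![t, 1 - t, t, 1 - t] : Fin 4 → ℝ) i ∧
      (![t, 1 - t, t, 1 - t] : Fin 4 → ℝ) i ∈ F := by
    have h2 := F.sub_mem F.one_mem ht
    intro i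
    fin_cases i <;> simp [h0, h1, ht, h2]
  have key := nnd_add_sum hb (Finset.univ : Finset (Fin 4))
    (fun l => Sum.elim (fun i => if i = p then (![t, 1 - t, t, 1 - t] : Fin 4 → ℝ) l else 0)
      (fun i => if i = l then 1 else 0))
    (fun l => Sum.elim (fun j => if l = 0 ∧ j = q then 1 else 0) (fun j => Cyc l j))
    (by
      rintro l (i | i) <;> simp only [Sum.elim_inl, Sum.elim_inr]
      · split_ifs
        · exact hα l
        · exact hz
      · split_ifs
        · exact ho
        · exact hz)
    (by
      rintro l (i | i) <;> simp only [Sum.elim_inl, Sum.elim_inr]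
      · split_ifs
        · exact ho
        · exact hz
      · exact cyc_mem F l i)
  rw [Finset.card_univ, Fintype.card_fin] at key
  convert key using 1
  · ext (i | i) (j | j)
    · simp only [Gad, Matrix.add_apply, Matrix.sum_apply, Matrix.vecMulVec_apply,
        Matrix.fromBlocks_apply₁₁, Sum.elim_inl, Fin.sum_univ_four, Matrix.sub_apply,
        Matrix.single_apply]
      by_cases hi : i = p <;> by_cases hj : j = q <;>
        simp [hi, hj, eq_comm (a := p), eq_comm (a := q)]
    · simp only [Gad, Matrix.add_apply, Matrix.sum_apply, Matrix.vecMulVec_apply,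
        Matrix.fromBlocks_apply₁₂, Sum.elim_inl, Sum.elim_inr, Fin.sum_univ_four]
      by_cases hi : i = p
      · fin_cases j <;> simp [hi, Cyc]
      · simp [hi]
    · simp only [Gad, Matrix.add_apply, Matrix.sum_apply, Matrix.vecMulVec_apply,
        Matrix.fromBlocks_apply₂₁, Sum.elim_inl, Sum.elim_inr, Fin.sum_univ_four]
      by_cases hj : j = q
      · fin_cases i <;> simp [hj]
      · simp [hj]
    · simp [Gad, Matrix.sum_apply, Matrix.vecMulVec_apply]

theorem gad_forw {F : Subfield ℝ} {m n : Type*} [DecidableEq m] [DecidableEq n]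
    {A : Matrix m n ℝ} {p : m} {q : n} {k : ℕ} (h : NNDecomp F (Gad A p q) k) :
    ∃ k', k = k' + 4 ∧ ∃ t ∈ F, 0 ≤ t ∧ t ≤ 1 ∧ NNDecomp F (A - Matrix.single p q t) k' := by
  classical
  obtain ⟨u, v, hu, hv, e⟩ := h
  have ent : ∀ i j, Gad A p q i j = ∑ l, u l i * v l j := by
    intro i j
    rw [e]; simp [Matrix.sum_apply, Matrix.vecMulVec_apply]
  have nn : ∀ l i j, 0 ≤ u l i * v l j := fun l i j => mul_nonneg (hu l i).1 (hv l j).1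
  have le : ∀ l i j, u l i * v l j ≤ Gad A p q i j := by
    intro l i j
    rw [ent]
    exact Finset.single_le_sum (f := fun l => u l i * v l j) (fun l _ => nn l i j)
      (Finset.mem_univ l)
  have zer : ∀ l i j, Gad A p q i j = 0 → u l i ≠ 0 → v l j = 0 := by
    intro l i j h0 h1
    have := le l i j
    have h2 : u l i * v l j = 0 := le_antisymm (h0 ▸ this) (nn l i j)
    exact (mul_eq_zero.1 h2).resolve_left h1
  have diag : ∀ i : Fin 4, ∃ l, u l (Sum.inr i) ≠ 0 ∧ v l (Sum.inr i) ≠ 0 := by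
    intro i
    have h1 : (∑ l, u l (Sum.inr i) * v l (Sum.inr i)) ≠ 0 := by
      rw [← ent]; simp [Gad, cyc_diag]
    obtain ⟨l, _, hl⟩ := Finset.exists_ne_zero_of_sum_ne_zero h1
    exact ⟨l, left_ne_zero_of_mul hl, right_ne_zero_of_mul hl⟩
  choose f hfu hfv using diag
  have fool : ∀ l (i j : Fin 4), i ≠ j → u l (Sum.inr i) ≠ 0 → v l (Sum.inr i) ≠ 0 →
      u l (Sum.inr j) ≠ 0 → v l (Sum.inr j) ≠ 0 → False := by
    intro l i j hij a b c d
    rcases cyc_fool i j hij with h | h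
    · exact d (zer l (Sum.inr i) (Sum.inr j) (by simpa [Gad] using h) a)
    · exact b (zer l (Sum.inr j) (Sum.inr i) (by simpa [Gad] using h) c)
  have finj : Function.Injective f := by
    intro i j hij
    by_contra hne
    exact fool (f i) i j hne (hfu i) (hfv i) (hij ▸ hfu j) (hij ▸ hfv j)
  let T : Finset (Fin k) := Finset.univ.filter fun l =>
    (∃ i : Fin 4, u l (Sum.inr i) ≠ 0) ∧ ∃ j : Fin 4, v l (Sum.inr j) ≠ 0
  have hT : ∀ l, l ∈ T ↔ (∃ i : Fin 4, u l (Sum.inr i) ≠ 0) ∧ ∃ j : Fin 4, v l (Sum.inr j) ≠ 0 := by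
    intro l; simp [T]
  have fT : Finset.univ.image f ⊆ T := by
    intro l hl
    obtain ⟨i, _, rfl⟩ := Finset.mem_image.1 hl
    exact (hT _).2 ⟨⟨i, hfu i⟩, ⟨i, hfv i⟩⟩
  have cI : (Finset.univ.image f).card = 4 := by
    rw [Finset.card_image_of_injective _ finj]; simp
  have c4 : 4 ≤ T.card := cI ▸ Finset.card_le_card fT
  have ck : T.card + Tᶜ.card = k := by simpa using Finset.card_add_card_compl T
  -- the terms in `T` vanish on the `A` block outside `(p,q)`
  have offu : ∀ l ∈ T, ∀ i, i ≠ p → u l (Sum.inl i) = 0 := by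
    intro l hl i hi
    by_contra h
    obtain ⟨-, j, hj⟩ := (hT l).1 hl
    exact hj (zer l (Sum.inl i) (Sum.inr j) (by simp [Gad, hi]) h)
  have offv : ∀ l ∈ T, ∀ j, j ≠ q → v l (Sum.inl j) = 0 := by
    intro l hl j hj
    obtain ⟨⟨i, hi⟩, -⟩ := (hT l).1 hl
    exact zer l (Sum.inr i) (Sum.inl j) (by simp [Gad, hj]) hi
  set s : ℝ := ∑ l ∈ T, u l (Sum.inl p) * v l (Sum.inl q) with hs
  have s0 : 0 ≤ s := Finset.sum_nonneg fun l _ => nn l _ _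
  have sF : s ∈ F := F.sum_mem fun l _ => F.mul_mem (hu l _).2 (hv l _).2
  have dec : A - Matrix.single p q s =
      0 + ∑ l ∈ Tᶜ, Matrix.vecMulVec (fun i => u l (Sum.inl i)) (fun j => v l (Sum.inl j)) := by
    ext i j
    have h1 := ent (Sum.inl i) (Sum.inl j)
    rw [← Finset.sum_add_sum_compl T] at h1
    have h2 : ∑ l ∈ T, u l (Sum.inl i) * v l (Sum.inl j) = Matrix.single p q s i j := by
      rw [Matrix.single_apply]
      split_ifs with hpq
      · rw [hs, hpq.1, hpq.2]
      · refine Finset.sum_eq_zero fun l hl => ?_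
        by_cases hi : i = p
        · rw [offv l hl j (fun hj => hpq ⟨hi.symm, hj.symm⟩), mul_zero]
        · rw [offu l hl i hi, zero_mul]
    rw [h2] at h1
    simp only [Gad, Matrix.fromBlocks_apply₁₁] at h1
    simp only [Matrix.sub_apply, Matrix.add_apply, Matrix.sum_apply, Matrix.vecMulVec_apply,
      Matrix.zero_apply, h1]
    ring
  have nd : NNDecomp F (A - Matrix.single p q s) (0 + Tᶜ.card) := by
    rw [dec]
    exact nnd_add_sum (nnd_zero F) _ _ _ (fun l i => hu l _) (fun l i => hv l _)
  rw [zero_add] at nd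
  refine ⟨k - 4, by omega, ?_⟩
  by_cases c5 : T.card = 4
  · refine ⟨s, sF, s0, ?_, nnd_mono nd (by omega)⟩
    have TI : Finset.univ.image f = T := Finset.eq_of_subset_of_card_le fT (by omega)
    have inT : ∀ l ∈ T, ∃ i, f i = l := by
      intro l hl
      rw [← TI] at hl
      obtain ⟨i, _, hi⟩ := Finset.mem_image.1 hl
      exact ⟨i, hi⟩
    have s1 : s = u (f 0) (Sum.inl p) * v (f 0) (Sum.inl q) := by
      rw [hs]
      refine Finset.sum_eq_single_of_mem _ (fT (Finset.mem_image_of_mem _ (Finset.mem_univ _))) ?_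
      intro l hl hne
      obtain ⟨i, rfl⟩ := inT l hl
      have hi : i ≠ 0 := fun h => hne (h ▸ rfl)
      rw [zer (f i) (Sum.inr i) (Sum.inl q) (by simp [Gad, hi]) (hfu i), mul_zero]
    have d1 : u (f 0) (Sum.inr 0) * v (f 0) (Sum.inr 0) = 1 := by
      have h1 := ent (Sum.inr 0) (Sum.inr 0)
      rw [Finset.sum_eq_single_of_mem (f 0) (Finset.mem_univ _)] at h1
      · rw [← h1]; simp [Gad, cyc_diag]
      · intro l _ hne
        by_contra h
        have a := left_ne_zero_of_mul h
        have b := right_ne_zero_of_mul h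
        obtain ⟨i, rfl⟩ := inT l ((hT l).2 ⟨⟨0, a⟩, ⟨0, b⟩⟩)
        exact fool (f i) i 0 (fun h => hne (h ▸ rfl)) (hfu i) (hfv i) a b
    have l1 := le (f 0) (Sum.inl p) (Sum.inr 0)
    have l2 := le (f 0) (Sum.inr 0) (Sum.inl q)
    simp only [Gad, Matrix.fromBlocks_apply₁₂, Matrix.fromBlocks_apply₂₁, Matrix.of_apply,
      if_true, and_self] at l1 l2
    calc s = (u (f 0) (Sum.inl p) * v (f 0) (Sum.inl q)) *
          (u (f 0) (Sum.inr 0) * v (f 0) (Sum.inr 0)) := by rw [d1, s1, mul_one]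
      _ = (u (f 0) (Sum.inl p) * v (f 0) (Sum.inr 0)) *
          (u (f 0) (Sum.inr 0) * v (f 0) (Sum.inl q)) := by ring
      _ ≤ 1 := mul_le_one₀ l1 (nn _ _ _) l2
  · refine ⟨0, F.zero_mem, le_refl _, zero_le_one, ?_⟩
    have := nnd_add_one nd (x := Pi.single p s) (y := Pi.single q 1) ?_ ?_
    · have e2 : A - Matrix.single p q 0 =
          A - Matrix.single p q s + Matrix.vecMulVec (Pi.single p s) (Pi.single q 1) := by
        ext i j
        by_cases hi : i = p <;> by_cases hj : j = q <;>
          simp [Matrix.single_apply, Matrix.vecMulVec_apply, Pi.single_apply, hi, hj,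
            eq_comm (a := p), eq_comm (a := q)]
      rw [e2]
      exact nnd_mono this (by omega)
    · intro i
      by_cases hi : i = p
      · subst hi; simpa using ⟨s0, sF⟩
      · simpa [hi] using F.zero_mem
    · intro i
      by_cases hi : i = q
      · subst hi; simpa using F.one_mem
      · simpa [hi] using F.zero_mem

theorem gad_iff {F : Subfield ℝ} {m n : Type*} [DecidableEq m] [DecidableEq n]
    {A : Matrix m n ℝ} {p : m} {q : n} {k : ℕ} : NNDecomp F (Gad A p q) k ↔
    ∃ k', k = k' + 4 ∧ ∃ t ∈ F, 0 ≤ t ∧ t ≤ 1 ∧ NNDecomp F (A - Matrix.single p q t) k' :=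
  ⟨gad_forw, by rintro ⟨k', rfl, t, ht, h0, h1, h⟩; exact gad_back ht h0 h1 h⟩

theorem gad_sub {m n : Type*} [DecidableEq m] [DecidableEq n]
    (A : Matrix m n ℝ) (p p' : m) (q q' : n) (t : ℝ) :
    Gad A p q - Matrix.single (Sum.inl p') (Sum.inl q') t = Gad (A - Matrix.single p' q' t) p q := by
  ext (i | i) (j | j) <;> simp [Gad, Matrix.single_apply]

/-- The three-fold gadget. -/
def Big : Matrix (((Fin 9 ⊕ Fin 4) ⊕ Fin 4) ⊕ Fin 4) (((Fin 9 ⊕ Fin 4) ⊕ Fin 4) ⊕ Fin 4) ℝ :=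
  Gad (Gad (Gad (M1mat 2 2 2) 3 4) (Sum.inl 2) (Sum.inl 3))
    (Sum.inl (Sum.inl 0)) (Sum.inl (Sum.inl 0))

/-- The index map. -/
def toF : ((Fin 9 ⊕ Fin 4) ⊕ Fin 4) ⊕ Fin 4 → Fin 21 :=
  Sum.elim (Sum.elim (Sum.elim (fun i => ⟨i, by omega⟩) (fun i => ⟨9 + i, by omega⟩))
    (fun i => ⟨13 + i, by omega⟩)) (fun i => ⟨17 + i, by omega⟩)

/-- The inverse index map. -/
def ofF : Fin 21 → ((Fin 9 ⊕ Fin 4) ⊕ Fin 4) ⊕ Fin 4 := fun i =>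
  if h : (i : ℕ) < 9 then Sum.inl (Sum.inl (Sum.inl ⟨i, h⟩))
  else if h : (i : ℕ) < 13 then Sum.inl (Sum.inl (Sum.inr ⟨i - 9, by omega⟩))
  else if h : (i : ℕ) < 17 then Sum.inl (Sum.inr ⟨i - 13, by omega⟩)
  else Sum.inr ⟨i - 17, by omega⟩

theorem to_of (i : Fin 21) : toF (ofF i) = i := by
  revert i; decide

set_option maxHeartbeats 8000000 in
theorem mcal_sub : (Mcal ℝ).submatrix toF toF = Big := by
  ext (((i | i) | i) | i) (((j | j) | j) | j)
  · fin_cases i <;> fin_cases j <;> rfl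
  all_goals
    fin_cases i <;> fin_cases j <;> simp [Big, Gad, toF, Mcal, Cyc]

theorem big_iff (F : Subfield ℝ) (k : ℕ) : NNDecomp F (Mcal ℝ) k ↔ NNDecomp F Big k := by
  constructor
  · intro h
    rw [← mcal_sub]; exact nnd_map h _ _
  · intro h
    have := nnd_map h ofF ofF
    rw [← mcal_sub, Matrix.submatrix_submatrix] at this
    have e : toF ∘ ofF = id := funext to_of
    rwa [e, Matrix.submatrix_id_id] at this

theorem m1_sub (x y z : ℝ) : M1mat 2 2 2 - Matrix.single 0 0 x - Matrix.single 2 3 y -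
    Matrix.single 3 4 z = M1mat (2 - x) (2 - y) (2 - z) := by
  ext i j
  simp only [M1mat, Matrix.sub_apply, Matrix.single_apply, Matrix.of_apply, Prod.mk.injEq]
  by_cases h1 : i = 0 ∧ j = 0
  · obtain ⟨rfl, rfl⟩ := h1; simp
  by_cases h2 : i = 2 ∧ j = 3
  · obtain ⟨rfl, rfl⟩ := h2; simp
  by_cases h3 : i = 3 ∧ j = 4
  · obtain ⟨rfl, rfl⟩ := h3; simp
  have h1' : ¬ (0 = i ∧ 0 = j) := fun h => h1 ⟨h.1.symm, h.2.symm⟩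
  have h2' : ¬ (2 = i ∧ 3 = j) := fun h => h2 ⟨h.1.symm, h.2.symm⟩
  have h3' : ¬ (3 = i ∧ 4 = j) := fun h => h3 ⟨h.1.symm, h.2.symm⟩
  simp only [h1, h2, h3, h1', h2', h3', if_false, sub_zero]

theorem main_iff (F : Subfield ℝ) (k : ℕ) : NNDecomp F (Mcal ℝ) k ↔
    ∃ k', k = 12 + k' ∧ ∃ a b c : ℝ, a ∈ F ∧ b ∈ F ∧ c ∈ F ∧
        a ∈ Set.Icc (1 : ℝ) 2 ∧ b ∈ Set.Icc (1 : ℝ) 2 ∧ c ∈ Set.Icc (1 : ℝ) 2 ∧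
        NNDecomp F (M1mat a b c) k' := by
  have two : (2 : ℝ) ∈ F := by
    have := F.add_mem F.one_mem F.one_mem
    rwa [one_add_one_eq_two] at this
  rw [big_iff, Big, gad_iff]
  simp only [gad_sub, gad_iff, m1_sub]
  constructor
  · rintro ⟨_, rfl, x, hx, x0, x1, _, rfl, y, hy, y0, y1, k', rfl, z, hz, z0, z1, h⟩
    exact ⟨k', by ring, _, _, _, F.sub_mem two hx, F.sub_mem two hy, F.sub_mem two hz,
      ⟨by linarith, by linarith⟩, ⟨by linarith, by linarith⟩, ⟨by linarith, by linarith⟩, h⟩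
  · rintro ⟨k', rfl, a, b, c, ha, hb, hc, ⟨a1, a2⟩, ⟨b1, b2⟩, ⟨c1, c2⟩, h⟩
    refine ⟨k' + 4 + 4, by ring, 2 - a, F.sub_mem two ha, by linarith, by linarith,
      k' + 4, rfl, 2 - b, F.sub_mem two hb, by linarith, by linarith,
      k', rfl, 2 - c, F.sub_mem two hc, by linarith, by linarith, ?_⟩
    simpa using h

set_option maxHeartbeats 4000000 in
theorem mcal_nonneg (F : Subfield ℝ) (i j : Fin 9) :
    0 ≤ Mcal ℝ (Fin.castLE (by norm_num) i) (Fin.castLE (by norm_num) j) ∧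
      Mcal ℝ (Fin.castLE (by norm_num) i) (Fin.castLE (by norm_num) j) ∈ F := by
  have h0 := F.zero_mem
  have h1 := F.one_mem
  have two : (2 : ℝ) ∈ F := by
    have := F.add_mem F.one_mem F.one_mem
    rwa [one_add_one_eq_two] at this
  fin_cases i <;> fin_cases j <;> simp [Mcal, h0, h1, two]

theorem stmt14 (F : Subfield ℝ) :
    nnRank F (Mcal ℝ) =
      12 + sInf {t | ∃ a b c : ℝ,
        a ∈ F ∧ b ∈ F ∧ c ∈ F ∧
        a ∈ Set.Icc (1 : ℝ) 2 ∧ b ∈ Set.Icc (1 : ℝ) 2 ∧ c ∈ Set.Icc (1 : ℝ) 2 ∧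
        nnRank F (M1mat a b c) = t} := by
  have two : (2 : ℝ) ∈ F := by
    have := F.add_mem F.one_mem F.one_mem
    rwa [one_add_one_eq_two] at this
  have ex : ∀ a b c : ℝ, a ∈ F → b ∈ F → c ∈ F → a ∈ Set.Icc (1 : ℝ) 2 →
      b ∈ Set.Icc (1 : ℝ) 2 → c ∈ Set.Icc (1 : ℝ) 2 →
      NNDecomp F (M1mat a b c) (nnRank F (M1mat a b c)) := by
    intro a b c ha hb hc ha' hb' hc'
    refine Nat.sInf_mem (s := {k | NNDecomp F (M1mat a b c) k}) (nnd_exists F _ ?_)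
    intro i j
    simp only [M1mat, Matrix.of_apply]
    split_ifs
    · exact ⟨by linarith [ha'.1], ha⟩
    · exact ⟨by linarith [hb'.1], hb⟩
    · exact ⟨by linarith [hc'.1], hc⟩
    · exact mcal_nonneg F _ _
  have hM : NNDecomp F (Mcal ℝ) (nnRank F (Mcal ℝ)) :=
    Nat.sInf_mem (s := {k | NNDecomp F (Mcal ℝ) k}) 
      ⟨_, (main_iff F _).2 ⟨_, rfl, 1, 1, 1, F.one_mem, F.one_mem, F.one_mem, by simp, by simp,
        by simp, ex 1 1 1 F.one_mem F.one_mem F.one_mem (by simp) (by simp) (by simp)⟩⟩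
  apply le_antisymm
  · have hne : {t | ∃ a b c : ℝ,
        a ∈ F ∧ b ∈ F ∧ c ∈ F ∧
        a ∈ Set.Icc (1 : ℝ) 2 ∧ b ∈ Set.Icc (1 : ℝ) 2 ∧ c ∈ Set.Icc (1 : ℝ) 2 ∧
        nnRank F (M1mat a b c) = t}.Nonempty :=
      ⟨_, 1, 1, 1, F.one_mem, F.one_mem, F.one_mem, by simp, by simp, by simp, rfl⟩
    obtain ⟨a, b, c, ha, hb, hc, ha', hb', hc', h⟩ := Nat.sInf_mem hne
    rw [← h]
    exact Nat.sInf_le ((main_iff F _).2 ⟨_, rfl, a, b, c, ha, hb, hc, ha', hb', hc',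
      ex a b c ha hb hc ha' hb' hc'⟩)
  · obtain ⟨k', hk, a, b, c, ha, hb, hc, ha', hb', hc', h⟩ := (main_iff F _).1 hM
    rw [hk]
    have h1 : nnRank F (M1mat a b c) ≤ k' := Nat.sInf_le h
    refine Nat.add_le_add_left (le_trans (Nat.sInf_le ?_) h1) 12
    exact ⟨a, b, c, ha, hb, hc, ha', hb', hc', rfl⟩
end
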